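/- arXiv:2206.03599 — 3 statements merged into one kernel-verified Lean document; each statement's English description precedes it below -/
import Mathlib

section
/- In the symplectic space F_q^{2N}, the number of totally isotropic subspaces of dimension k+1 containing a fixed totally isotropic subspace of dimension m+1 equals [N-m-1 choose k-m]_q · ∏_{i=1}^{k-m} (q^{N-m-i} + 1). -/
/-- The Gaussian binomial coefficient `[n choose k]_q`. -/
def gaussBinom (q n k : ℕ) : ℕ :=
  (∏ i ∈ Finset.range k, (q ^ (n - i) - 1)) / ∏ i ∈ Finset.range k, (q ^ (i + 1) - 1)

/-- A submodule is totally isotropic for a bilinear form `B` if `B` vanishes identically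
on it. -/
def IsTotallyIsotropic {F V : Type*} [Field F] [AddCommGroup V] [Module F V]
    (B : V →ₗ[F] V →ₗ[F] F) (S : Submodule F V) : Prop :=
  ∀ x ∈ S, ∀ y ∈ S, B x y = 0

open Module Finset

/-- The `q`-falling factorial satisfies the `q`-Pascal recurrence. -/
theorem prod_pow_sub_one_succ {q : ℕ} (hq : 0 < q) (n r : ℕ) :
    ∏ i ∈ range (r + 1), (q ^ (n + 1 - i) - 1) =
      q ^ (r + 1) * ∏ i ∈ range (r + 1), (q ^ (n - i) - 1) +
        (q ^ (r + 1) - 1) * ∏ i ∈ range r, (q ^ (n - i) - 1) := by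
  rw [prod_range_succ', prod_range_succ]
  simp only [Nat.add_sub_add_right, Nat.sub_zero]
  rcases le_or_gt r n with hrn | hrn
  · have hfactor : q ^ (n + 1) - 1 = q ^ (r + 1) * (q ^ (n - r) - 1) + (q ^ (r + 1) - 1) := by
      have hpow : q ^ (n + 1) = q ^ (r + 1) * q ^ (n - r) := by
        rw [← pow_add]; congr 1; omega
      have hle : q ^ (r + 1) ≤ q ^ (r + 1) * q ^ (n - r) :=
        Nat.le_mul_of_pos_right _ (Nat.pow_pos hq)
      have hpos : 0 < q ^ (r + 1) := Nat.pow_pos hq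
      rw [hpow, Nat.mul_sub, mul_one]
      omega
    rw [hfactor]
    ring
  · have hzero : ∏ i ∈ range r, (q ^ (n - i) - 1) = 0 :=
      prod_eq_zero (mem_range.2 hrn) (by simp)
    simp [hzero]

/-- The quotient defining the Gaussian binomial coefficient is exact. -/
theorem prod_pow_succ_sub_one_dvd {q : ℕ} (hq : 0 < q) (n r : ℕ) :
    ∏ i ∈ range r, (q ^ (i + 1) - 1) ∣ ∏ i ∈ range r, (q ^ (n - i) - 1) := by
  induction n generalizing r with
  | zero =>
    cases r with
    | zero => simp
    | succ r => rw [prod_range_succ' (fun i => q ^ (0 - i) - 1)]; simp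
  | succ n ih =>
    cases r with
    | zero => simp
    | succ r =>
      rw [prod_pow_sub_one_succ hq]
      refine dvd_add (Dvd.dvd.mul_left (ih _) _) ?_
      rw [prod_range_succ, mul_comm]
      exact mul_dvd_mul_left _ (ih r)

theorem gaussBinom_mul_prod {q : ℕ} (hq : 0 < q) (n r : ℕ) :
    gaussBinom q n r * ∏ i ∈ range r, (q ^ (i + 1) - 1) =
      ∏ i ∈ range r, (q ^ (n - i) - 1) :=
  Nat.div_mul_cancel (prod_pow_succ_sub_one_dvd hq n r)

section Isotropic

variable {F V : Type*} [Field F] [AddCommGroup V] [Module F V] {B : V →ₗ[F] V →ₗ[F] F}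

theorem IsTotallyIsotropic.sup_span_singleton (halt : B.IsAlt) {M : Submodule F V}
    (hM : IsTotallyIsotropic B M) {v : V} (hv : ∀ x ∈ M, B x v = 0) :
    IsTotallyIsotropic B (M ⊔ F ∙ v) := by
  intro x hx y hy
  obtain ⟨a, ha, _, hs, rfl⟩ := Submodule.mem_sup.1 hx
  obtain ⟨b, hb, _, ht, rfl⟩ := Submodule.mem_sup.1 hy
  obtain ⟨s, rfl⟩ := Submodule.mem_span_singleton.1 hs
  obtain ⟨t, rfl⟩ := Submodule.mem_span_singleton.1 ht
  simp [hM a ha b hb, hv a ha, halt.eq_iff.1 (hv b hb), halt.self_eq_zero v]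

theorem finrank_orthogonal_of_isAlt [FiniteDimensional F V] (halt : B.IsAlt)
    (hB : B.SeparatingLeft) (M : Submodule F V) :
    finrank F (LinearMap.BilinForm.orthogonal B M) = finrank F V - finrank F M :=
  LinearMap.BilinForm.finrank_orthogonal
    (halt.isRefl.nondegenerate_iff_separatingLeft.2 hB) M

theorem IsTotallyIsotropic.le_orthogonal {M : Submodule F V} (hM : IsTotallyIsotropic B M) :
    M ≤ LinearMap.BilinForm.orthogonal B M :=
  fun x hx y hy => hM y hy x hx

theorem IsTotallyIsotropic.exists_finrank_eq_succ [FiniteDimensional F V] (halt : B.IsAlt)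
    (hB : B.SeparatingLeft) {M : Submodule F V} (hM : IsTotallyIsotropic B M)
    (hdim : 2 * finrank F M < finrank F V) :
    ∃ M' : Submodule F V, IsTotallyIsotropic B M' ∧ finrank F M' = finrank F M + 1 := by
  have hlt : M < LinearMap.BilinForm.orthogonal B M := by
    refine lt_of_le_of_ne hM.le_orthogonal fun heq => ?_
    have := finrank_orthogonal_of_isAlt halt hB M
    rw [← heq] at this
    omega
  obtain ⟨v, hv, hvM⟩ := SetLike.exists_of_lt hlt
  exact ⟨M ⊔ F ∙ v, hM.sup_span_singleton halt hv, Submodule.finrank_sup_span_singleton hvM⟩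

open Classical in
theorem Submodule.card_filter_mem_and_notMem [Fintype F] [Fintype V] {W U : Submodule F V}
    (hWU : W ≤ U) :
    #{v : V | v ∈ U ∧ v ∉ W} = Fintype.card F ^ finrank F U - Fintype.card F ^ finrank F W := by
  have hcard (S : Submodule F V) : #{v : V | v ∈ S} = Fintype.card F ^ finrank F S := by
    rw [← Module.card_eq_pow_finrank (K := F) (V := S), Fintype.card_subtype]
  rw [← hcard, ← hcard, ← card_sdiff_of_subset (fun v hv => by simp_all [hWU _])]
  congr 1
  ext v
  simp

variable [Fintype F] [Finite V]

/-- Double counting of the pairs `(v, S)` with `v ∈ S \ M`. -/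
theorem card_totallyIsotropic_ge_recurrence {N a r c : ℕ} (halt : B.IsAlt)
    (hB : B.SeparatingLeft) (hV : finrank F V = 2 * N)
    {M : Submodule F V} (hM : IsTotallyIsotropic B M) (ha : finrank F M = a)
    (hc : ∀ M' : Submodule F V, IsTotallyIsotropic B M' → finrank F M' = a + 1 →
      Nat.card {S : Submodule F V // M' ≤ S ∧ IsTotallyIsotropic B S ∧
        finrank F S = a + 1 + r} = c) :
    Nat.card {S : Submodule F V // M ≤ S ∧ IsTotallyIsotropic B S ∧
        finrank F S = a + (r + 1)} * (Fintype.card F ^ (a + (r + 1)) - Fintype.card F ^ a) =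
      (Fintype.card F ^ (2 * N - a) - Fintype.card F ^ a) * c := by
  classical
  have := Fintype.ofFinite V
  have := Fintype.ofFinite (Submodule F V)
  have hvectors := Submodule.card_filter_mem_and_notMem hM.le_orthogonal
  rw [finrank_orthogonal_of_isAlt halt hB, hV, ha] at hvectors
  rw [Nat.card_eq_fintype_card, Fintype.card_subtype, ← hvectors]
  refine card_mul_eq_card_mul (fun S v => v ∈ S) ?_ ?_
  · intro S hS
    obtain ⟨hMS, hS, hdim⟩ := (mem_filter.1 hS).2
    rw [← hdim, ← ha, ← Submodule.card_filter_mem_and_notMem hMS, bipartiteAbove, filter_filter]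
    congr 1
    ext v
    simp only [mem_filter, mem_univ, true_and]
    exact ⟨fun h => ⟨h.2, h.1.2⟩, fun h => ⟨⟨fun x hx => hS x (hMS hx) v h.1, h.2⟩, h.1⟩⟩
  · intro v hv
    obtain ⟨hv, hvM⟩ := (mem_filter.1 hv).2
    rw [← hc (M ⊔ F ∙ v) (hM.sup_span_singleton halt hv)
      (by rw [Submodule.finrank_sup_span_singleton hvM, ha]),
      Nat.card_eq_fintype_card, Fintype.card_subtype, bipartiteBelow, filter_filter]
    congr 1
    ext S
    simp only [mem_filter, mem_univ, true_and, sup_le_iff, Submodule.span_singleton_le_iff_mem,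
      show a + (r + 1) = a + 1 + r by omega]
    tauto

theorem card_totallyIsotropic_ge_mul_prod {N : ℕ} (halt : B.IsAlt)
    (hB : B.SeparatingLeft) (hV : finrank F V = 2 * N) (r a : ℕ) (har : a + r ≤ N)
    (M : Submodule F V) (hM : IsTotallyIsotropic B M) (ha : finrank F M = a) :
    Nat.card {S : Submodule F V // M ≤ S ∧ IsTotallyIsotropic B S ∧ finrank F S = a + r} *
        ∏ i ∈ range r, (Fintype.card F ^ (i + 1) - 1) =
      ∏ i ∈ range r, (Fintype.card F ^ (2 * (N - a - i)) - 1) := by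
  have hq : 1 < Fintype.card F := Fintype.one_lt_card
  induction r generalizing a M with
  | zero =>
    have : Unique {S : Submodule F V // M ≤ S ∧ IsTotallyIsotropic B S ∧
        finrank F S = a + 0} :=
      { default := ⟨M, le_rfl, hM, ha⟩
        uniq := fun S => Subtype.ext
          (Submodule.eq_of_le_of_finrank_eq S.2.1 (ha.trans S.2.2.2.symm)).symm }
    simp
  | succ r ih =>
    set q := Fintype.card F
    have hden : 0 < ∏ i ∈ range r, (q ^ (i + 1) - 1) :=
      prod_pos fun i _ => Nat.sub_pos_of_lt (Nat.one_lt_pow (by omega) hq)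
    set P := ∏ i ∈ range r, (q ^ (2 * (N - (a + 1) - i)) - 1) with hP
    have hrec := card_totallyIsotropic_ge_recurrence
      (c := P / ∏ i ∈ range r, (q ^ (i + 1) - 1)) halt hB hV hM ha
      (r := r) fun M' hM' ha' => by
        rw [hP, ← ih (a + 1) (by omega) M' hM' ha', Nat.mul_div_cancel _ hden]
    have hcD : P / (∏ i ∈ range r, (q ^ (i + 1) - 1)) * ∏ i ∈ range r, (q ^ (i + 1) - 1) = P := by
      obtain ⟨M', hM', ha'⟩ := hM.exists_finrank_eq_succ halt hB (by omega)
      exact Nat.div_mul_cancel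
        (Dvd.intro_left _ (ih (a + 1) (by omega) M' hM' (by rw [ha', ha])))
    have hqa : 0 < q ^ a := Nat.pow_pos (by omega)
    rw [show 2 * N - a = a + 2 * (N - a) by omega, pow_add q a, pow_add q a,
      ← Nat.mul_sub_one, ← Nat.mul_sub_one, mul_left_comm, mul_assoc (q ^ a)] at hrec
    have hrec := Nat.eq_of_mul_eq_mul_left hqa hrec
    rw [prod_range_succ, prod_range_succ' _ r]
    simp only [Nat.sub_zero, show ∀ i, N - a - (i + 1) = N - (a + 1) - i by omega]
    rw [← hP, ← hcD, mul_left_comm, hrec]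
    ring

end Isotropic

/-- In the symplectic space `F_q^{2N}`, the number of totally isotropic subspaces of
dimension `k+1` containing a fixed totally isotropic subspace of dimension `m+1` equals
`[N-m-1 choose k-m]_q · ∏_{i=1}^{k-m} (q^{N-m-i} + 1)`. -/
theorem card_totally_isotropic_through_fixed (F : Type*) [Field F] [Fintype F]
    (q N k m : ℕ) (hq : Fintype.card F = q) (hmk : m ≤ k) (hk : k + 1 ≤ N)
    (B : (Fin (2 * N) → F) →ₗ[F] (Fin (2 * N) → F) →ₗ[F] F)
    (halt : ∀ x, B x x = 0)
    (hnd : ∀ x, (∀ y, B x y = 0) → x = 0)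
    (M : Submodule F (Fin (2 * N) → F))
    (hM : IsTotallyIsotropic B M) (hMrk : Module.finrank F M = m + 1) :
    Nat.card {S : Submodule F (Fin (2 * N) → F) //
        M ≤ S ∧ IsTotallyIsotropic B S ∧ Module.finrank F S = k + 1} =
      gaussBinom q (N - m - 1) (k - m) *
        ∏ i ∈ Finset.range (k - m), (q ^ (N - m - (i + 1)) + 1) := by
  have hq1 : 1 < q := hq ▸ Fintype.one_lt_card
  have hden : 0 < ∏ i ∈ range (k - m), (q ^ (i + 1) - 1) :=
    prod_pos fun i _ => Nat.sub_pos_of_lt (Nat.one_lt_pow (by omega) hq1)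
  have hcount := card_totallyIsotropic_ge_mul_prod halt hnd (finrank_fin_fun F) (k - m) (m + 1)
    (by omega) M hM hMrk
  rw [show m + 1 + (k - m) = k + 1 by omega, hq] at hcount
  refine Nat.eq_of_mul_eq_mul_right hden ?_
  rw [hcount, mul_right_comm, gaussBinom_mul_prod (by omega), ← prod_mul_distrib]
  refine prod_congr rfl fun i _ => ?_
  rw [show N - m - (i + 1) = N - m - 1 - i by omega, show N - (m + 1) - i = N - m - 1 - i by omega,
    mul_comm 2, pow_mul, mul_comm]
  simpa using Nat.sq_sub_sq (q ^ (N - m - 1 - i)) 1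
end

section
/- For N ≥ 2, define D_l(N) = [2N choose 4]_2 − [N choose 4]_2 · ∏_{i=1}^{4}(2^{N+1-i}+1) − 7·[N choose 3]_2 · 2^{2N-6} · ∏_{i=1}^{3}(2^{N+1-i}+1)/3. Then D_l(N) equals the number of 4-dimensional linear subspaces of F_2^{2N} (with a nondegenerate alternating form) that contain no totally isotropic 3-dimensional subspace. -/
/-- The closed formula for the number of linear `N`-qubit doilies:
`D_l(N) = [2N 4]_2 − [N 4]_2·∏_{i=1}^{4}(2^{N+1-i}+1) − 7·[N 3]_2·2^{2N-6}·∏_{i=1}^{3}(2^{N+1-i}+1)/3`. -/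
noncomputable def DlQ (N : ℕ) : ℚ :=
  (gaussBinom 2 (2 * N) 4 : ℚ)
    - (gaussBinom 2 N 4 : ℚ) * ∏ i ∈ Finset.range 4, ((2 : ℚ) ^ (N - i) + 1)
    - 7 * (gaussBinom 2 N 3 : ℚ) * (2 : ℚ) ^ (2 * N - 6) *
        (∏ i ∈ Finset.range 3, ((2 : ℚ) ^ (N - i) + 1)) / 3

section SymplecticCounting

variable {V : Type*} [AddCommGroup V] [Module (ZMod 2) V]

/-- Ordered pairs of vectors pairing to one under `B`. -/
abbrev HyperbolicPair (B : V →ₗ[ZMod 2] V →ₗ[ZMod 2] ZMod 2) : Type _ :=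
  {p : V × V // B p.1 p.2 = 1}

/-- The vectors orthogonal to both `a` and `b`. -/
def orthogonalPair (B : V →ₗ[ZMod 2] V →ₗ[ZMod 2] ZMod 2) (a b : V) :
    Submodule (ZMod 2) V :=
  LinearMap.ker ((B a).prod (B b))

lemma mem_orthogonalPair {B : V →ₗ[ZMod 2] V →ₗ[ZMod 2] ZMod 2} {a b x : V} :
    x ∈ orthogonalPair B a b ↔ B a x = 0 ∧ B b x = 0 := by
  simp [orthogonalPair]

/-- Two mutually orthogonal hyperbolic pairs, i.e. a symplectic basis of a hyperbolic 4-space. -/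
abbrev HyperbolicQuad (B : V →ₗ[ZMod 2] V →ₗ[ZMod 2] ZMod 2) : Type _ :=
  Σ p : HyperbolicPair B, HyperbolicPair
    (B.domRestrict₁₂ (orthogonalPair B p.1.1 p.1.2) (orthogonalPair B p.1.1 p.1.2))

lemma apply_comm_of_alternating {B : V →ₗ[ZMod 2] V →ₗ[ZMod 2] ZMod 2}
    (halt : ∀ x, B x x = 0) (x y : V) : B x y = B y x := by
  have h := halt (x + y)
  simp only [map_add, LinearMap.add_apply, halt, zero_add, add_zero] at h
  rw [add_comm] at h
  exact CharTwo.add_eq_zero.mp h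

lemma natCard_fiber_one (f : V →ₗ[ZMod 2] ZMod 2) (hf : f ≠ 0) [Finite V] :
    2 * Nat.card {b // f b = 1} = Nat.card V := by
  obtain ⟨b₀, hb₀⟩ : ∃ b, f b = 1 := by
    by_contra! h
    have hzero : ∀ t : ZMod 2, t ≠ 1 → t = 0 := by decide
    exact hf (LinearMap.ext fun b => hzero _ (h b))
  have e : {b // f b = 1} ≃ {b // ¬ f b = 1} :=
    (Equiv.addRight b₀).subtypeEquiv fun b => by
      simp only [Equiv.coe_addRight, map_add, hb₀]
      generalize f b = t
      revert t
      decide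
  classical
  have h := Nat.card_congr (Equiv.sumCompl fun b => f b = 1)
  rw [Nat.card_sum, ← Nat.card_congr e] at h
  omega

lemma two_mul_natCard_hyperbolicPair [Finite V] {B : V →ₗ[ZMod 2] V →ₗ[ZMod 2] ZMod 2}
    (hnd : ∀ x, (∀ y, B x y = 0) → x = 0) :
    2 * Nat.card (HyperbolicPair B) = (Nat.card V - 1) * Nat.card V := by
  have e : HyperbolicPair B ≃ Σ a : {a : V // a ≠ 0}, {b // B a.1 b = 1} :=
    { toFun := fun p => ⟨⟨p.1.1, by
        rintro h
        have := p.2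
        simp [h] at this⟩, p.1.2, p.2⟩
      invFun := fun q => ⟨(q.1.1, q.2.1), q.2.2⟩
      left_inv := fun _ => rfl
      right_inv := fun _ => rfl }
  classical
  have := Fintype.ofFinite V
  rw [Nat.card_congr e, Nat.card_sigma, Finset.mul_sum,
    Finset.sum_congr rfl (fun (a : {a : V // a ≠ 0}) _ =>
      natCard_fiber_one (B a.1) fun h => a.2 (hnd _ fun y => by simp [h]))]
  simp [Fintype.card_subtype_compl]

lemma finrank_orthogonalPair [FiniteDimensional (ZMod 2) V]
    {B : V →ₗ[ZMod 2] V →ₗ[ZMod 2] ZMod 2} (halt : ∀ x, B x x = 0) {a b : V}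
    (hab : B a b = 1) :
    Module.finrank (ZMod 2) (orthogonalPair B a b) + 2 = Module.finrank (ZMod 2) V := by
  have hba : B b a = 1 := by rw [apply_comm_of_alternating halt, hab]
  have hsurj : Function.Surjective ((B a).prod (B b)) := fun ⟨s, t⟩ =>
    ⟨s • b + t • a, by simp [halt, hab, hba]⟩
  have h := LinearMap.finrank_range_add_finrank_ker ((B a).prod (B b))
  rw [LinearMap.range_eq_top.mpr hsurj, finrank_top] at h
  simp only [Module.finrank_prod, Module.finrank_self] at h
  rw [orthogonalPair]
  omega

lemma orthogonalPair_nondegenerate {B : V →ₗ[ZMod 2] V →ₗ[ZMod 2] ZMod 2}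
    (halt : ∀ x, B x x = 0) (hnd : ∀ x, (∀ y, B x y = 0) → x = 0) {a b : V}
    (hab : B a b = 1) (x : orthogonalPair B a b)
    (hx : ∀ y, B.domRestrict₁₂ (orthogonalPair B a b) (orthogonalPair B a b) x y = 0) :
    x = 0 := by
  have hba : B b a = 1 := by rw [apply_comm_of_alternating halt, hab]
  obtain ⟨hax, hbx⟩ := mem_orthogonalPair.mp x.2
  refine Subtype.ext (hnd _ fun v => ?_)
  have hv : B x.1 (v + B b v • a + B a v • b) = 0 := hx ⟨v + B b v • a + B a v • b, mem_orthogonalPair.mpr (by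
    simp [halt, hab, hba, CharTwo.add_self_eq_zero])⟩
  simpa [apply_comm_of_alternating halt x.1 a, apply_comm_of_alternating halt x.1 b,
    hax, hbx] using hv

lemma natCard_eq_two_pow_finrank [FiniteDimensional (ZMod 2) V] :
    Nat.card V = 2 ^ Module.finrank (ZMod 2) V := by
  rw [Module.natCard_eq_pow_finrank (K := ZMod 2), Nat.card_zmod]

lemma natCard_hyperbolicQuad [FiniteDimensional (ZMod 2) V]
    {B : V →ₗ[ZMod 2] V →ₗ[ZMod 2] ZMod 2} (halt : ∀ x, B x x = 0)
    (hnd : ∀ x, (∀ y, B x y = 0) → x = 0) {m : ℕ}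
    (hm : Module.finrank (ZMod 2) V = m + 2) :
    4 * Nat.card (HyperbolicQuad B) =
      (2 ^ (m + 2) - 1) * 2 ^ (m + 2) * ((2 ^ m - 1) * 2 ^ m) := by
  have : Finite V := Module.finite_of_finite (ZMod 2)
  have hpairs := two_mul_natCard_hyperbolicPair hnd
  rw [natCard_eq_two_pow_finrank (V := V), hm] at hpairs
  have hinner (p : HyperbolicPair B) : 2 * Nat.card (HyperbolicPair
      (B.domRestrict₁₂ (orthogonalPair B p.1.1 p.1.2) (orthogonalPair B p.1.1 p.1.2))) =
      (2 ^ m - 1) * 2 ^ m := by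
    rw [two_mul_natCard_hyperbolicPair (orthogonalPair_nondegenerate halt hnd p.2),
      natCard_eq_two_pow_finrank]
    have h := finrank_orthogonalPair halt p.2
    rw [hm] at h
    rw [Nat.add_right_cancel h]
  have := Fintype.ofFinite (HyperbolicPair B)
  rw [← hpairs, Nat.card_sigma, show (4 : ℕ) = 2 * 2 from rfl, mul_assoc, Finset.mul_sum,
    Finset.sum_congr rfl fun p _ => hinner p]
  simp only [Finset.sum_const, Finset.card_univ, Nat.card_eq_fintype_card, smul_eq_mul]
  ring

/-- The four vectors underlying a hyperbolic quadruple. -/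
def HyperbolicQuad.vec {B : V →ₗ[ZMod 2] V →ₗ[ZMod 2] ZMod 2} (q : HyperbolicQuad B) :
    Fin 4 → V :=
  ![q.1.1.1, q.1.1.2, q.2.1.1, q.2.1.2]

lemma HyperbolicQuad.vec_injective {B : V →ₗ[ZMod 2] V →ₗ[ZMod 2] ZMod 2} :
    Function.Injective (HyperbolicQuad.vec (B := B)) := by
  rintro ⟨⟨⟨a, b⟩, hab⟩, ⟨⟨c, hc⟩, ⟨d, hd⟩⟩, hcd⟩
    ⟨⟨⟨a', b'⟩, hab'⟩, ⟨⟨c', hc'⟩, ⟨d', hd'⟩⟩, hcd'⟩ h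
  obtain rfl : a = a' := congrFun h 0
  obtain rfl : b = b' := congrFun h 1
  obtain rfl : c = c' := congrFun h 2
  obtain rfl : d = d' := congrFun h 3
  rfl

/-- The Gram relations satisfied by a symplectic basis of a hyperbolic 4-space. -/
def IsHyperbolicFrame (B : V →ₗ[ZMod 2] V →ₗ[ZMod 2] ZMod 2) (v : Fin 4 → V) : Prop :=
  (B (v 0) (v 1) = 1 ∧ B (v 2) (v 3) = 1) ∧
    (B (v 0) (v 2) = 0 ∧ B (v 1) (v 2) = 0) ∧ B (v 0) (v 3) = 0 ∧ B (v 1) (v 3) = 0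

lemma HyperbolicQuad.isHyperbolicFrame {B : V →ₗ[ZMod 2] V →ₗ[ZMod 2] ZMod 2}
    (q : HyperbolicQuad B) : IsHyperbolicFrame B q.vec :=
  ⟨⟨q.1.2, q.2.2⟩, mem_orthogonalPair.mp q.2.1.1.2, mem_orthogonalPair.mp q.2.1.2.2⟩

lemma IsHyperbolicFrame.exists_quad {B : V →ₗ[ZMod 2] V →ₗ[ZMod 2] ZMod 2} {v : Fin 4 → V}
    (hv : IsHyperbolicFrame B v) : ∃ q : HyperbolicQuad B, q.vec = v := by
  obtain ⟨⟨h01, h23⟩, h2, h3⟩ := hv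
  refine ⟨⟨⟨(v 0, v 1), h01⟩,
    ⟨(⟨v 2, mem_orthogonalPair.mpr h2⟩, ⟨v 3, mem_orthogonalPair.mpr h3⟩), h23⟩⟩, ?_⟩
  ext i
  fin_cases i <;> rfl

lemma IsHyperbolicFrame.coeff_eq_zero {B : V →ₗ[ZMod 2] V →ₗ[ZMod 2] ZMod 2}
    (halt : ∀ x, B x x = 0) {v : Fin 4 → V} (hv : IsHyperbolicFrame B v) (g : Fin 4 → ZMod 2)
    (hg : ∀ i, B (∑ j, g j • v j) (v i) = 0) : g = 0 := by
  obtain ⟨⟨h01, h23⟩, ⟨h02, h12⟩, h03, h13⟩ := hv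
  have hs := apply_comm_of_alternating halt
  have h0 := hg 0
  have h1 := hg 1
  have h2 := hg 2
  have h3 := hg 3
  simp only [Fin.sum_univ_four, map_add, map_smul, LinearMap.add_apply, LinearMap.smul_apply,
    halt, hs (v 1) (v 0), hs (v 2) (v 0), hs (v 3) (v 0), hs (v 2) (v 1), hs (v 3) (v 1),
    hs (v 3) (v 2), h01, h23, h02, h12, h03, h13, smul_eq_mul, mul_zero, mul_one, add_zero,
    zero_add] at h0 h1 h2 h3
  ext i
  fin_cases i <;> assumption

lemma IsHyperbolicFrame.linearIndependent {B : V →ₗ[ZMod 2] V →ₗ[ZMod 2] ZMod 2}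
    (halt : ∀ x, B x x = 0) {v : Fin 4 → V} (hv : IsHyperbolicFrame B v) :
    LinearIndependent (ZMod 2) v :=
  Fintype.linearIndependent_iff.mpr fun g hg =>
    congrFun (hv.coeff_eq_zero halt g fun i => by simp [hg])

lemma IsHyperbolicFrame.finrank_span {B : V →ₗ[ZMod 2] V →ₗ[ZMod 2] ZMod 2}
    (halt : ∀ x, B x x = 0) {v : Fin 4 → V} (hv : IsHyperbolicFrame B v) :
    Module.finrank (ZMod 2) (Submodule.span (ZMod 2) (Set.range v)) = 4 := by
  rw [finrank_span_eq_card (hv.linearIndependent halt), Fintype.card_fin]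

lemma IsHyperbolicFrame.span_nondegenerate {B : V →ₗ[ZMod 2] V →ₗ[ZMod 2] ZMod 2}
    (halt : ∀ x, B x x = 0) {v : Fin 4 → V} (hv : IsHyperbolicFrame B v)
    {x : V} (hx : x ∈ Submodule.span (ZMod 2) (Set.range v))
    (h : ∀ y ∈ Submodule.span (ZMod 2) (Set.range v), B x y = 0) : x = 0 := by
  obtain ⟨g, rfl⟩ := (Submodule.mem_span_range_iff_exists_fun (ZMod 2)).mp hx
  simp [hv.coeff_eq_zero halt g fun i => h _ (Submodule.subset_span ⟨i, rfl⟩)]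

lemma two_mul_finrank_le_of_isTotallyIsotropic [FiniteDimensional (ZMod 2) V]
    {B : V →ₗ[ZMod 2] V →ₗ[ZMod 2] ZMod 2} (halt : ∀ x, B x x = 0)
    {W T : Submodule (ZMod 2) V} (hW : ∀ x ∈ W, (∀ y ∈ W, B x y = 0) → x = 0)
    (hTW : T ≤ W) (hT : IsTotallyIsotropic B T) :
    2 * Module.finrank (ZMod 2) T ≤ Module.finrank (ZMod 2) W := by
  let C : LinearMap.BilinForm (ZMod 2) W := B.domRestrict₁₂ W W
  have hC : C.IsAlt := fun x => halt x
  have hCnd : C.Nondegenerate :=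
    (hC.isRefl.nondegenerate_iff_separatingLeft).mpr fun x hx =>
      Subtype.ext (hW x.1 x.2 fun y hy => hx ⟨y, hy⟩)
  have h := LinearMap.BilinForm.finrank_orthogonal hCnd (T.comap W.subtype)
  have hle : T.comap W.subtype ≤ C.orthogonal (T.comap W.subtype) :=
    fun x hx y hy => hT _ hy _ hx
  have h2 := Submodule.finrank_mono hle
  have h3 := Submodule.finrank_le (T.comap W.subtype)
  rw [← (Submodule.comapSubtypeEquivOfLe hTW).finrank_eq]
  omega

/-- A vector of a 4-space orthogonal to the whole space extends to a totally isotropic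
3-dimensional subspace. -/
lemma exists_isTotallyIsotropic_of_radical [FiniteDimensional (ZMod 2) V]
    {B : V →ₗ[ZMod 2] V →ₗ[ZMod 2] ZMod 2} (halt : ∀ x, B x x = 0)
    {W : Submodule (ZMod 2) V} (hW : Module.finrank (ZMod 2) W = 4) {x : V} (hxW : x ∈ W)
    (hx0 : x ≠ 0) (hx : ∀ y ∈ W, B x y = 0) :
    ∃ T ≤ W, IsTotallyIsotropic B T ∧ Module.finrank (ZMod 2) T = 3 := by
  have hs := apply_comm_of_alternating halt
  have exists_notMem {S U : Submodule (ZMod 2) V}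
      (h : Module.finrank (ZMod 2) S < Module.finrank (ZMod 2) U) : ∃ y ∈ U, y ∉ S := by
    by_contra! hle
    exact absurd (Submodule.finrank_mono (show U ≤ S from hle)) (by omega)
  have h1 : LinearIndependent (ZMod 2) ![x] := LinearIndependent.of_subsingleton 0 hx0
  obtain ⟨y, hyW, hy⟩ := exists_notMem
    (S := Submodule.span (ZMod 2) (Set.range ![x])) (U := W) (by
      rw [finrank_span_eq_card h1, hW]; simp)
  have h2 : LinearIndependent (ZMod 2) ![y, x] := linearIndependent_finCons.mpr ⟨h1, hy⟩
  have hker : 3 ≤ Module.finrank (ZMod 2) (W ⊓ LinearMap.ker (B y) : Submodule (ZMod 2) V) := by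
    have h := LinearMap.finrank_range_add_finrank_ker ((B y).domRestrict W)
    have hr := Submodule.finrank_le (LinearMap.range ((B y).domRestrict W))
    rw [Module.finrank_self] at hr
    have hk : (LinearMap.ker ((B y).domRestrict W)).map W.subtype ≤ W ⊓ LinearMap.ker (B y) := by
      rintro _ ⟨z, hz, rfl⟩
      exact ⟨z.2, hz⟩
    have hk' := Submodule.finrank_mono hk
    rw [Submodule.finrank_map_subtype_eq] at hk'
    omega
  obtain ⟨z, ⟨hzW, hyz⟩, hz⟩ := exists_notMem
    (S := Submodule.span (ZMod 2) (Set.range ![y, x])) (U := W ⊓ LinearMap.ker (B y)) (by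
      rw [finrank_span_eq_card h2, Fintype.card_fin]; omega)
  have h3 : LinearIndependent (ZMod 2) ![z, y, x] := linearIndependent_finCons.mpr ⟨h2, hz⟩
  replace hyz : B y z = 0 := hyz
  refine ⟨Submodule.span (ZMod 2) (Set.range ![z, y, x]), ?_, ?_, ?_⟩
  · rw [Submodule.span_le]
    rintro _ ⟨i, rfl⟩
    fin_cases i <;> assumption
  · intro u hu w hw
    obtain ⟨f, rfl⟩ := (Submodule.mem_span_range_iff_exists_fun (ZMod 2)).mp hu
    obtain ⟨g, rfl⟩ := (Submodule.mem_span_range_iff_exists_fun (ZMod 2)).mp hw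
    simp [Fin.sum_univ_three, halt, hx y hyW, hx z hzW, hs y x, hs z x, hs z y, hyz]
  · rw [finrank_span_eq_card h3, Fintype.card_fin]

/-- The defining property of the span of a linear doily. -/
def IsDoilySpan (B : V →ₗ[ZMod 2] V →ₗ[ZMod 2] ZMod 2) (W : Submodule (ZMod 2) V) : Prop :=
  Module.finrank (ZMod 2) W = 4 ∧ ∀ T : Submodule (ZMod 2) V,
    T ≤ W → IsTotallyIsotropic B T → Module.finrank (ZMod 2) T ≠ 3

lemma IsDoilySpan.nondegenerate [FiniteDimensional (ZMod 2) V]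
    {B : V →ₗ[ZMod 2] V →ₗ[ZMod 2] ZMod 2} (halt : ∀ x, B x x = 0)
    {W : Submodule (ZMod 2) V} (hW : IsDoilySpan B W) (x : W)
    (hx : ∀ y, B.domRestrict₁₂ W W x y = 0) : x = 0 := by
  by_contra h0
  obtain ⟨T, hTW, hT, h3⟩ := exists_isTotallyIsotropic_of_radical halt hW.1 x.2
    (fun h => h0 (Subtype.ext h)) fun y hy => hx ⟨y, hy⟩
  exact hW.2 T hTW hT h3

lemma IsHyperbolicFrame.isDoilySpan_span [FiniteDimensional (ZMod 2) V]
    {B : V →ₗ[ZMod 2] V →ₗ[ZMod 2] ZMod 2} (halt : ∀ x, B x x = 0) {v : Fin 4 → V}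
    (hv : IsHyperbolicFrame B v) :
    IsDoilySpan B (Submodule.span (ZMod 2) (Set.range v)) := by
  refine ⟨hv.finrank_span halt, fun T hTW hT h3 => ?_⟩
  have h := two_mul_finrank_le_of_isTotallyIsotropic halt
    (fun x hx h => hv.span_nondegenerate halt hx h) hTW hT
  rw [hv.finrank_span halt, h3] at h
  omega

/-- The hyperbolic quadruples inside a doily span are its symplectic bases. -/
noncomputable def quadOfDoilySpan (B : V →ₗ[ZMod 2] V →ₗ[ZMod 2] ZMod 2) :
    (Σ W : {W : Submodule (ZMod 2) V // IsDoilySpan B W},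
      HyperbolicQuad (B.domRestrict₁₂ W.1 W.1)) → HyperbolicQuad B :=
  fun p => (IsHyperbolicFrame.exists_quad (B := B) (v := fun i => (p.2.vec i : V))
    p.2.isHyperbolicFrame).choose

lemma quadOfDoilySpan_vec (B : V →ₗ[ZMod 2] V →ₗ[ZMod 2] ZMod 2)
    (p : Σ W : {W : Submodule (ZMod 2) V // IsDoilySpan B W},
      HyperbolicQuad (B.domRestrict₁₂ W.1 W.1)) :
    (quadOfDoilySpan B p).vec = fun i => (p.2.vec i : V) :=
  (IsHyperbolicFrame.exists_quad (B := B) (v := fun i => (p.2.vec i : V))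
    p.2.isHyperbolicFrame).choose_spec

lemma span_quadOfDoilySpan [FiniteDimensional (ZMod 2) V]
    {B : V →ₗ[ZMod 2] V →ₗ[ZMod 2] ZMod 2} (halt : ∀ x, B x x = 0)
    (p : Σ W : {W : Submodule (ZMod 2) V // IsDoilySpan B W},
      HyperbolicQuad (B.domRestrict₁₂ W.1 W.1)) :
    Submodule.span (ZMod 2) (Set.range (quadOfDoilySpan B p).vec) = p.1.1 := by
  refine Submodule.eq_of_le_of_finrank_eq ?_ ?_
  · rw [Submodule.span_le, quadOfDoilySpan_vec]
    rintro _ ⟨i, rfl⟩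
    exact (p.2.vec i).2
  · rw [(quadOfDoilySpan B p).isHyperbolicFrame.finrank_span halt, p.1.2.1]

lemma quadOfDoilySpan_bijective [FiniteDimensional (ZMod 2) V]
    {B : V →ₗ[ZMod 2] V →ₗ[ZMod 2] ZMod 2} (halt : ∀ x, B x x = 0) :
    Function.Bijective (quadOfDoilySpan B) := by
  constructor
  · intro p p' h
    have hspan : p.1 = p'.1 := Subtype.ext (by
      rw [← span_quadOfDoilySpan halt p, h, span_quadOfDoilySpan halt p'])
    have hvec : (fun i => (p.2.vec i : V)) = fun i => (p'.2.vec i : V) := by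
      rw [← quadOfDoilySpan_vec, h, quadOfDoilySpan_vec]
    obtain ⟨W, q⟩ := p
    obtain ⟨W', q'⟩ := p'
    obtain rfl : W = W' := hspan
    congr 1
    exact HyperbolicQuad.vec_injective (funext fun i => Subtype.ext (congrFun hvec i))
  · intro q
    have hq := q.isHyperbolicFrame
    obtain ⟨q', hq'⟩ := IsHyperbolicFrame.exists_quad
      (B := B.domRestrict₁₂ (Submodule.span (ZMod 2) (Set.range q.vec))
        (Submodule.span (ZMod 2) (Set.range q.vec)))
      (v := fun i => ⟨q.vec i, Submodule.subset_span ⟨i, rfl⟩⟩) hq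
    refine ⟨⟨⟨_, hq.isDoilySpan_span halt⟩, q'⟩, HyperbolicQuad.vec_injective ?_⟩
    rw [quadOfDoilySpan_vec]
    simp only [hq']

lemma natCard_isDoilySpan [FiniteDimensional (ZMod 2) V]
    {B : V →ₗ[ZMod 2] V →ₗ[ZMod 2] ZMod 2} (halt : ∀ x, B x x = 0)
    (hnd : ∀ x, (∀ y, B x y = 0) → x = 0) {m : ℕ}
    (hm : Module.finrank (ZMod 2) V = m + 2) :
    2880 * Nat.card {W : Submodule (ZMod 2) V // IsDoilySpan B W} =
      (2 ^ (m + 2) - 1) * 2 ^ (m + 2) * ((2 ^ m - 1) * 2 ^ m) := by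
  have : Finite V := Module.finite_of_finite (ZMod 2)
  have : Finite (Submodule (ZMod 2) V) := Finite.of_injective _ SetLike.coe_injective
  have := Fintype.ofFinite {W : Submodule (ZMod 2) V // IsDoilySpan B W}
  have hfib (W : {W : Submodule (ZMod 2) V // IsDoilySpan B W}) :
      4 * Nat.card (HyperbolicQuad (B.domRestrict₁₂ W.1 W.1)) = 2880 :=
    natCard_hyperbolicQuad (B := B.domRestrict₁₂ W.1 W.1) (m := 2) (fun x => halt x) (W.2.nondegenerate halt) W.2.1
  rw [← natCard_hyperbolicQuad halt hnd hm,
    ← Nat.card_eq_of_bijective _ (quadOfDoilySpan_bijective halt), Nat.card_sigma,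
    Finset.mul_sum, Finset.sum_congr rfl fun W _ => hfib W]
  simp [mul_comm]

end SymplecticCounting

lemma dvd_prod_two_pow_sub_one_four (n : ℕ) :
    315 ∣ (2 ^ (n + 4) - 1) * (2 ^ (n + 3) - 1) * (2 ^ (n + 2) - 1) * (2 ^ (n + 1) - 1) := by
  have hperiod : (2 : ZMod 315) ^ n = 2 ^ (n % 12) := by
    conv_lhs => rw [← Nat.div_add_mod n 12, pow_add, pow_mul,
      show (2 : ZMod 315) ^ 12 = 1 by decide, one_pow, one_mul]
  have hcases : ∀ r < 12, ((2 : ZMod 315) ^ r * 2 ^ 4 - 1) * (2 ^ r * 2 ^ 3 - 1) *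
      (2 ^ r * 2 ^ 2 - 1) * (2 ^ r * 2 ^ 1 - 1) = 0 := by
    decide
  rw [← ZMod.natCast_eq_zero_iff]
  push_cast [Nat.one_le_two_pow]
  simp only [pow_add, hperiod]
  exact hcases _ (Nat.mod_lt _ (by norm_num))

lemma dvd_prod_two_pow_sub_one_three (n : ℕ) :
    21 ∣ (2 ^ (n + 3) - 1) * (2 ^ (n + 2) - 1) * (2 ^ (n + 1) - 1) := by
  have hperiod : (2 : ZMod 21) ^ n = 2 ^ (n % 6) := by
    conv_lhs => rw [← Nat.div_add_mod n 6, pow_add, pow_mul,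
      show (2 : ZMod 21) ^ 6 = 1 by decide, one_pow, one_mul]
  have hcases : ∀ r < 6, ((2 : ZMod 21) ^ r * 2 ^ 3 - 1) * (2 ^ r * 2 ^ 2 - 1) *
      (2 ^ r * 2 ^ 1 - 1) = 0 := by
    decide
  rw [← ZMod.natCast_eq_zero_iff]
  push_cast [Nat.one_le_two_pow]
  simp only [pow_add, hperiod]
  exact hcases _ (Nat.mod_lt _ (by norm_num))

lemma cast_gaussBinom_two_four (n : ℕ) :
    (gaussBinom 2 (n + 4) 4 : ℚ) =
      (2 ^ (n + 4) - 1) * (2 ^ (n + 3) - 1) * (2 ^ (n + 2) - 1) * (2 ^ (n + 1) - 1) / 315 := by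
  have h : gaussBinom 2 (n + 4) 4 =
      (2 ^ (n + 4) - 1) * (2 ^ (n + 3) - 1) * (2 ^ (n + 2) - 1) * (2 ^ (n + 1) - 1) / 315 := by
    simp [gaussBinom, Finset.prod_range_succ]
  rw [h, Nat.cast_div (dvd_prod_two_pow_sub_one_four n) (by norm_num)]
  simp [Nat.cast_sub, Nat.one_le_two_pow]

lemma cast_gaussBinom_two_three (n : ℕ) :
    (gaussBinom 2 (n + 3) 3 : ℚ) =
      (2 ^ (n + 3) - 1) * (2 ^ (n + 2) - 1) * (2 ^ (n + 1) - 1) / 21 := by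
  have h : gaussBinom 2 (n + 3) 3 =
      (2 ^ (n + 3) - 1) * (2 ^ (n + 2) - 1) * (2 ^ (n + 1) - 1) / 21 := by
    simp [gaussBinom, Finset.prod_range_succ]
  rw [h, Nat.cast_div (dvd_prod_two_pow_sub_one_three n) (by norm_num)]
  simp [Nat.cast_sub, Nat.one_le_two_pow]

lemma DlQ_eq (k : ℕ) :
    2880 * DlQ (k + 2) =
      (2 ^ (2 * k + 4) - 1) * 2 ^ (2 * k + 4) * ((2 ^ (2 * k + 2) - 1) * 2 ^ (2 * k + 2)) := by
  match k with
  | 0 => norm_num [DlQ, gaussBinom, Finset.prod_range_succ]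
  | 1 => norm_num [DlQ, gaussBinom, Finset.prod_range_succ]
  | m + 2 =>
    have h8 := cast_gaussBinom_two_four (2 * m + 4)
    have h4 := cast_gaussBinom_two_four m
    have h3 := cast_gaussBinom_two_three (m + 1)
    rw [DlQ, show 2 * (m + 2 + 2) = 2 * m + 4 + 4 by ring, h8,
      show m + 2 + 2 = m + 4 by ring, h4, show m + 4 = m + 1 + 3 by ring, h3]
    simp only [Finset.prod_range_succ, Finset.prod_range_zero,
      show m + 1 + 3 - 0 = m + 4 by omega, show m + 1 + 3 - 1 = m + 3 by omega,
      show m + 1 + 3 - 2 = m + 2 by omega, show m + 1 + 3 - 3 = m + 1 by omega,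
      show 2 * m + 4 + 4 - 6 = 2 * m + 2 by omega]
    ring

/-- For `N ≥ 2`, `D_l(N)` equals the number of 4-dimensional linear subspaces of
`F_2^{2N}` (with a nondegenerate alternating form) that contain no totally isotropic
3-dimensional subspace. -/
theorem card_linear_doily_spans_eq_DlQ (N : ℕ) (hN : 2 ≤ N)
    (B : (Fin (2 * N) → ZMod 2) →ₗ[ZMod 2] (Fin (2 * N) → ZMod 2) →ₗ[ZMod 2] ZMod 2)
    (halt : ∀ x, B x x = 0)
    (hnd : ∀ x, (∀ y, B x y = 0) → x = 0) :
    (Nat.card {W : Submodule (ZMod 2) (Fin (2 * N) → ZMod 2) //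
        Module.finrank (ZMod 2) W = 4 ∧
        ∀ T : Submodule (ZMod 2) (Fin (2 * N) → ZMod 2),
          T ≤ W → IsTotallyIsotropic B T → Module.finrank (ZMod 2) T ≠ 3} : ℚ) =
      DlQ N := by
  obtain ⟨k, rfl⟩ := Nat.exists_eq_add_of_le' hN
  have h := natCard_isDoilySpan halt hnd (m := 2 * k + 2) (by simp; ring)
  have h' : (2880 : ℚ) * Nat.card {W : Submodule (ZMod 2) (Fin (2 * (k + 2)) → ZMod 2) //
      IsDoilySpan B W} = 2880 * DlQ (k + 2) := by
    rw [DlQ_eq]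
    simpa [Nat.cast_sub, Nat.one_le_two_pow] using congrArg (Nat.cast (R := ℚ)) h
  exact mul_left_cancel₀ (by norm_num) h'
end

section
/- In F_2^6 with a nondegenerate alternating form, every 5-dimensional subspace contains exactly 15 of the 31 four-dimensional subspaces that possess a totally isotropic 3-dimensional subspace, and these 15 all contain the pole of the hyperplane; the remaining 16 four-dimensional subspaces of the hyperplane contain no totally isotropic 3-dimensional subspace. -/
/-- The orthogonal complement `S^⊥` of a submodule with respect to a bilinear form. -/
def perpB {F V : Type*} [Field F] [AddCommGroup V] [Module F V]
    (B : V →ₗ[F] V →ₗ[F] F) (S : Submodule F V) : Submodule F V :=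
  ⨅ s ∈ S, LinearMap.ker (B.flip s)

open Module in
/-- Over `F_2`, the subspaces of codimension one in `H` that contain `U ≤ H` correspond to the
nonzero linear forms on `H` vanishing on `U`. -/
lemma card_hyperplanes_containing {V : Type*} [AddCommGroup V] [Module (ZMod 2) V]
    [FiniteDimensional (ZMod 2) V] {H U : Submodule (ZMod 2) V} (hU : U ≤ H) {n : ℕ}
    (hn : finrank (ZMod 2) H = n + 1) :
    Nat.card {W : Submodule (ZMod 2) V // W ≤ H ∧ finrank (ZMod 2) W = n ∧ U ≤ W} =
      2 ^ (finrank (ZMod 2) H - finrank (ZMod 2) U) - 1 := by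
  set A := (U.comap H.subtype).dualAnnihilator
  have hAcard : Nat.card {f : A // f ≠ 0} =
      2 ^ (finrank (ZMod 2) H - finrank (ZMod 2) U) - 1 := by
    have hfin : finrank (ZMod 2) A = finrank (ZMod 2) H - finrank (ZMod 2) U := by
      have h := Subspace.finrank_add_finrank_dualAnnihilator_eq (U.comap H.subtype)
      rw [(Submodule.comapSubtypeEquivOfLe hU).finrank_eq] at h
      exact Nat.eq_sub_of_add_eq' h
    have : Finite A := Module.finite_of_finite (ZMod 2)
    have hc := Module.natCard_eq_pow_finrank (K := ZMod 2) (V := A)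
    rw [Nat.card_zmod, hfin] at hc
    rw [← hc]
    have := Set.ncard_compl ({0} : Set A)
    rwa [Set.ncard_singleton] at this
  rw [← hAcard]
  symm
  refine Nat.card_eq_of_bijective
    (fun f => ⟨(LinearMap.ker (f.1.1 : Dual (ZMod 2) H)).map H.subtype,
      Submodule.map_subtype_le _ _, ?_, ?_⟩) ⟨?_, ?_⟩
  · have hf : (f.1.1 : Dual (ZMod 2) H) ≠ 0 := fun h => f.2 (Subtype.ext h)
    have := Module.Dual.finrank_ker_add_one_of_ne_zero hf
    rw [Submodule.finrank_map_subtype_eq]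
    omega
  · intro u hu
    exact ⟨⟨u, hU hu⟩, (Submodule.mem_dualAnnihilator _).1 f.1.2 _ hu, rfl⟩
  · intro f g hfg
    have hker : LinearMap.ker (f.1.1 : Dual (ZMod 2) H) = LinearMap.ker g.1.1 :=
      Submodule.map_injective_of_injective H.injective_subtype (congrArg Subtype.val hfg)
    refine Subtype.ext (Subtype.ext (LinearMap.ext fun x => ?_))
    have hx : f.1.1 x = 0 ↔ g.1.1 x = 0 := by
      rw [← LinearMap.mem_ker, hker, LinearMap.mem_ker]
    have key : ∀ a b : ZMod 2, (a = 0 ↔ b = 0) → a = b := by decide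
    exact key _ _ hx
  · rintro ⟨W, hWH, hW, hUW⟩
    have hWfin : finrank (ZMod 2) (W.comap H.subtype) = n := by
      rw [(Submodule.comapSubtypeEquivOfLe hWH).finrank_eq, hW]
    obtain ⟨f, hf0, hf⟩ := Submodule.exists_le_ker_of_lt_top (W.comap H.subtype)
      (Submodule.lt_top_of_finrank_lt_finrank (by omega))
    have hfA : f ∈ A := (Submodule.mem_dualAnnihilator _).2 fun x hx => hf (hUW hx)
    refine ⟨⟨⟨f, hfA⟩, fun h => hf0 (congrArg Subtype.val h)⟩, Subtype.ext ?_⟩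
    have hker := Module.Dual.finrank_ker_add_one_of_ne_zero hf0
    have heq : W.comap H.subtype = LinearMap.ker f :=
      Submodule.eq_of_le_of_finrank_eq hf (by omega)
    change (LinearMap.ker f).map H.subtype = W
    rw [← heq, Submodule.map_comap_subtype, inf_eq_right.2 hWH]

section Perp

open Module

variable {F V : Type*} [Field F] [AddCommGroup V] [Module F V] {B : V →ₗ[F] V →ₗ[F] F}

lemma mem_perpB {S : Submodule F V} {x : V} : x ∈ perpB B S ↔ ∀ s ∈ S, B x s = 0 := by
  simp [perpB]

lemma perpB_anti {S T : Submodule F V} (h : S ≤ T) : perpB B T ≤ perpB B S :=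
  fun _ hx => mem_perpB.2 fun s hs => mem_perpB.1 hx s (h hs)

lemma isTotallyIsotropic_iff_le_perpB {S : Submodule F V} :
    IsTotallyIsotropic B S ↔ S ≤ perpB B S :=
  ⟨fun h x hx => mem_perpB.2 (h x hx), fun h _ hx => mem_perpB.1 (h hx)⟩

lemma finrank_perpB [FiniteDimensional F V] (halt : B.IsAlt) (hnd : B.SeparatingLeft)
    (S : Submodule F V) : finrank F (perpB B S) = finrank F V - finrank F S := by
  have hB : B.Nondegenerate := ⟨hnd, fun x h => hnd x fun y => halt.isRefl _ _ (h y)⟩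
  have hperp : perpB B S = LinearMap.BilinForm.orthogonal B S := by
    ext x
    rw [mem_perpB, LinearMap.BilinForm.mem_orthogonal_iff]
    exact ⟨fun h s hs => halt.isRefl _ _ (h s hs), fun h s hs => halt.isRefl _ _ (h s hs)⟩
  rw [hperp, LinearMap.BilinForm.finrank_orthogonal hB]

lemma perpB_perpB [FiniteDimensional F V] (halt : B.IsAlt) (hnd : B.SeparatingLeft)
    (S : Submodule F V) : perpB B (perpB B S) = S := by
  refine (Submodule.eq_of_le_of_finrank_eq
    (fun x hx => mem_perpB.2 fun s hs => halt.isRefl _ _ (mem_perpB.1 hs x hx)) ?_).symm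
  have := S.finrank_le
  rw [finrank_perpB halt hnd, finrank_perpB halt hnd]
  omega

lemma isTotallyIsotropic_of_finrank_eq_one (halt : B.IsAlt) {S : Submodule F V}
    (hS : finrank F S = 1) : IsTotallyIsotropic B S := by
  obtain ⟨v, -, hv⟩ := finrank_eq_one_iff'.1 hS
  intro x hx y hy
  obtain ⟨c, hc⟩ := hv ⟨x, hx⟩
  obtain ⟨d, hd⟩ := hv ⟨y, hy⟩
  obtain rfl : c • (v : V) = x := congrArg Subtype.val hc
  obtain rfl : d • (v : V) = y := congrArg Subtype.val hd
  simp [halt.self_eq_zero (v : V)]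

lemma IsTotallyIsotropic.sup_span_singleton_s17 (halt : B.IsAlt) {T : Submodule F V}
    (hT : IsTotallyIsotropic B T) {y : V} (hy : y ∈ perpB B T) :
    IsTotallyIsotropic B (T ⊔ F ∙ y) := by
  intro a ha b hb
  obtain ⟨s, hs, c, hc, rfl⟩ := Submodule.mem_sup.1 ha
  obtain ⟨t, ht, d, hd, rfl⟩ := Submodule.mem_sup.1 hb
  obtain ⟨c, rfl⟩ := Submodule.mem_span_singleton.1 hc
  obtain ⟨d, rfl⟩ := Submodule.mem_span_singleton.1 hd
  have hyt := mem_perpB.1 hy t ht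
  have hsy := halt.isRefl _ _ (mem_perpB.1 hy s hs)
  simp [hT s hs t ht, hyt, hsy, halt.self_eq_zero y]

/-- A totally isotropic subspace of `W` can be enlarged inside `W` as soon as it is properly
contained in the part of `W` orthogonal to it. -/
lemma IsTotallyIsotropic.exists_finrank_succ [FiniteDimensional F V] (halt : B.IsAlt)
    {T W : Submodule F V} (hT : IsTotallyIsotropic B T) (hTW : T ≤ W)
    (hlt : finrank F T < finrank F (W ⊓ perpB B T : Submodule F V)) :
    ∃ T', T ≤ T' ∧ T' ≤ W ∧ IsTotallyIsotropic B T' ∧ finrank F T' = finrank F T + 1 := by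
  obtain ⟨y, hy, hyT⟩ := SetLike.not_le_iff_exists.1
    fun h => hlt.not_ge (Submodule.finrank_mono (s := W ⊓ perpB B T) (t := T) h)
  exact ⟨T ⊔ F ∙ y, le_sup_left, sup_le hTW ((Submodule.span_singleton_le_iff_mem _ _).2 hy.1),
    hT.sup_span_singleton_s17 halt hy.2, Submodule.finrank_sup_span_singleton hyT⟩

/-- In a symplectic space of dimension six, a 4-subspace of a hyperplane contains a totally
isotropic 3-subspace if and only if it contains the pole of the hyperplane. -/
lemma exists_isTotallyIsotropic_iff_perpB_le [FiniteDimensional F V] (halt : B.IsAlt)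
    (hnd : B.SeparatingLeft) (hV : finrank F V = 6) {H W : Submodule F V}
    (hH : finrank F H = 5) (hWH : W ≤ H) (hW : finrank F W = 4) :
    (∃ T, T ≤ W ∧ IsTotallyIsotropic B T ∧ finrank F T = 3) ↔ perpB B H ≤ W := by
  have hperp := finrank_perpB halt hnd
  constructor
  · rintro ⟨T, hTW, hT, hT3⟩
    have hTT : T = perpB B T := Submodule.eq_of_le_of_finrank_eq
      (isTotallyIsotropic_iff_le_perpB.1 hT) (by rw [hperp]; omega)
    calc perpB B H ≤ perpB B T := perpB_anti (hTW.trans hWH)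
      _ = T := hTT.symm
      _ ≤ W := hTW
  · intro hPW
    have hP1 : finrank F (perpB B H) = 1 := by rw [hperp]; omega
    have hHP : perpB B (perpB B H) = H := perpB_perpB halt hnd H
    have hPiso : IsTotallyIsotropic B (perpB B H) :=
      isTotallyIsotropic_of_finrank_eq_one halt hP1
    obtain ⟨T, hPT, hTW, hT, hT2⟩ := hPiso.exists_finrank_succ halt hPW (by
      rw [hHP, inf_eq_left.2 hWH]; omega)
    have hT4 : finrank F (perpB B T) = 4 := by rw [hperp]; omega
    have hsup : finrank F (W ⊔ perpB B T : Submodule F V) ≤ 5 :=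
      hH ▸ Submodule.finrank_mono (sup_le hWH ((perpB_anti hPT).trans hHP.le))
    have hinf := Submodule.finrank_sup_add_finrank_inf_eq W (perpB B T)
    obtain ⟨T', -, hT'W, hT', hT'3⟩ := hT.exists_finrank_succ halt hTW (by omega)
    exact ⟨T', hT'W, hT', by omega⟩

end Perp

/-- In `F_2^6` with a nondegenerate alternating form, every 5-dimensional subspace `H`
contains exactly 31 four-dimensional subspaces; exactly 15 of them possess a totally
isotropic 3-dimensional subspace, and each of these 15 contains the pole `H^⊥` of the
hyperplane; the remaining 16 four-dimensional subspaces of `H` contain no totally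
isotropic 3-dimensional subspace. -/
theorem hyperplane_sixteen_doily_spans
    (B : (Fin 6 → ZMod 2) →ₗ[ZMod 2] (Fin 6 → ZMod 2) →ₗ[ZMod 2] ZMod 2)
    (halt : ∀ x, B x x = 0)
    (hnd : ∀ x, (∀ y, B x y = 0) → x = 0)
    (H : Submodule (ZMod 2) (Fin 6 → ZMod 2))
    (hH : Module.finrank (ZMod 2) H = 5) :
    Nat.card {W : Submodule (ZMod 2) (Fin 6 → ZMod 2) //
        W ≤ H ∧ Module.finrank (ZMod 2) W = 4} = 31 ∧
    Nat.card {W : Submodule (ZMod 2) (Fin 6 → ZMod 2) //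
        W ≤ H ∧ Module.finrank (ZMod 2) W = 4 ∧
        ∃ T : Submodule (ZMod 2) (Fin 6 → ZMod 2),
          T ≤ W ∧ IsTotallyIsotropic B T ∧ Module.finrank (ZMod 2) T = 3} = 15 ∧
    (∀ W : Submodule (ZMod 2) (Fin 6 → ZMod 2),
      W ≤ H → Module.finrank (ZMod 2) W = 4 →
      (∃ T : Submodule (ZMod 2) (Fin 6 → ZMod 2),
        T ≤ W ∧ IsTotallyIsotropic B T ∧ Module.finrank (ZMod 2) T = 3) →
      perpB B H ≤ W) ∧
    Nat.card {W : Submodule (ZMod 2) (Fin 6 → ZMod 2) //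
        W ≤ H ∧ Module.finrank (ZMod 2) W = 4 ∧
        ∀ T : Submodule (ZMod 2) (Fin 6 → ZMod 2),
          T ≤ W → IsTotallyIsotropic B T → Module.finrank (ZMod 2) T ≠ 3} = 16 := by
  have hV : Module.finrank (ZMod 2) (Fin 6 → ZMod 2) = 6 := by simp
  have hiff := fun W hWH hW =>
    exists_isTotallyIsotropic_iff_perpB_le (W := W) halt hnd hV hH hWH hW
  have hP1 : Module.finrank (ZMod 2) (perpB B H) = 1 := by
    rw [finrank_perpB halt hnd, hV, hH]
  have hPH : perpB B H ≤ H := by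
    have h := isTotallyIsotropic_iff_le_perpB.1 (isTotallyIsotropic_of_finrank_eq_one halt hP1)
    rwa [perpB_perpB halt hnd] at h
  have h31 : Nat.card {W : Submodule (ZMod 2) (Fin 6 → ZMod 2) //
      W ≤ H ∧ Module.finrank (ZMod 2) W = 4} = 31 := by
    simpa [hH] using card_hyperplanes_containing (bot_le : ⊥ ≤ H) (n := 4) hH
  have h15 : Nat.card {W : Submodule (ZMod 2) (Fin 6 → ZMod 2) //
      W ≤ H ∧ Module.finrank (ZMod 2) W = 4 ∧
      ∃ T : Submodule (ZMod 2) (Fin 6 → ZMod 2),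
        T ≤ W ∧ IsTotallyIsotropic B T ∧ Module.finrank (ZMod 2) T = 3} = 15 := by
    rw [Nat.card_congr (Equiv.subtypeEquivRight fun W =>
      and_congr_right fun hWH => and_congr_right fun hW => hiff W hWH hW),
      card_hyperplanes_containing hPH (n := 4) hH, hH, hP1]
    rfl
  refine ⟨h31, h15, fun W hWH hW => (hiff W hWH hW).1, ?_⟩
  have hdiff := Set.ncard_sdiff
    (s := {W : Submodule (ZMod 2) (Fin 6 → ZMod 2) | W ≤ H ∧ Module.finrank (ZMod 2) W = 4 ∧
      ∃ T : Submodule (ZMod 2) (Fin 6 → ZMod 2),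
        T ≤ W ∧ IsTotallyIsotropic B T ∧ Module.finrank (ZMod 2) T = 3})
    (t := {W | W ≤ H ∧ Module.finrank (ZMod 2) W = 4})
    (fun W hW => ⟨hW.1, hW.2.1⟩) (Set.toFinite _)
  rw [← Nat.card_coe_set_eq, ← Nat.card_coe_set_eq, ← Nat.card_coe_set_eq] at hdiff
  calc _ = _ := Nat.card_congr (Equiv.subtypeEquivRight fun W => ?_)
    _ = _ := hdiff
    _ = 31 - 15 := congrArg₂ (· - ·) h31 h15
  simp only [Set.mem_sdiff, Set.mem_ofPred_eq]
  grind
end
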